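/- Uniqueness in Theorem I: suppose G assigns a rational number G_{g,L}(n_1, …, n_L) to every integer g, every integer L and every tuple of positive integers n_1, …, n_L, with G_{g,L} = 0 whenever g < 0 or L ≤ 0, with G_{0,1}(n) = 1 for all positive integers n, and satisfying for all g ≥ 0, L ≥ 1 with L + 2g − 1 ≥ 1 the recursion (L + 2g − 1) · G_{g,L}(n_1, …, n_L) = Σ_{1 ≤ i < j ≤ L} n_i n_j · G_{g,L−1}(n_i + n_j + 2, n_1, …, ň_i, …, ň_j, …, n_L) + (1/2) Σ_{i=1}^{L} n_i · Σ_{x=1}^{n_i+1} G_{g−1,L+1}(n_i + 2 − x, x, n_1, …, ň_i, …, n_L). Then for all g ≥ 0, L ≥ 1 and positive integers n_1, …, n_L, G_{g,L}(n_1, …, n_L) = N_{g,L}(n_1, …, n_L), the value given by the explicit formula. -/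

import Mathlib

open Finset

/-- The explicit formula `N_{g,L}(n_1, …, n_L)` (genus `g : ℤ`, boundary lengths given by
the list `ns` of length `L`), with the convention that the value is `0` when `g < 0` or
`L = 0`. -/
noncomputable def Ncal (g : ℤ) (ns : List ℕ) : ℚ :=
  if g < 0 ∨ ns = [] then 0
  else
    (1 / 4 ^ g.toNat) * (ns.map (fun n => (n : ℚ))).prod *
      ((Nat.factorial (ns.sum + 4 * g.toNat + 2 * ns.length - 3) : ℚ) /
        (Nat.factorial (ns.sum + 2 * g.toNat + ns.length - 1) : ℚ)) *
      ∑ lam ∈ Finset.Nat.antidiagonalTuple ns.length g.toNat,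
        ∏ k : Fin ns.length,
          (Nat.factorial (2 * lam k + ns.get k) : ℚ) /
            ((Nat.factorial (ns.get k) : ℚ) * (Nat.factorial (2 * lam k + 1) : ℚ))

section SignedGeometricSeries

open PowerSeries

/-- The geometric series `1 / (1 - X)`. -/
noncomputable def geomSeries : ℚ⟦X⟧ := PowerSeries.mk 1

/-- The alternating geometric series `1 / (1 + X)`. -/
noncomputable def altGeomSeries : ℚ⟦X⟧ := rescale (-1) geomSeries

/-- The odd part of `(1 - X) ^ (-n)`. -/
noncomputable def oddPow (n : ℕ) : ℚ⟦X⟧ := C (1 / 2) * (geomSeries ^ n - altGeomSeries ^ n)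

/-- The even part of `(1 - X) ^ (-n)`. -/
noncomputable def evenPow (n : ℕ) : ℚ⟦X⟧ := C (1 / 2) * (geomSeries ^ n + altGeomSeries ^ n)

theorem C_half_mul_two : (C (1 / 2) : ℚ⟦X⟧) * 2 = 1 := by
  have : (2 : ℚ⟦X⟧) = C 2 := (map_ofNat C 2).symm
  rw [this, ← map_mul]
  norm_num

theorem geomSeries_mul_one_sub_X : geomSeries * (1 - X) = 1 :=
  mk_one_mul_one_sub_eq_one ℚ

theorem altGeomSeries_mul_one_add_X : altGeomSeries * (1 + X) = 1 := by
  have h := congrArg (rescale (-1 : ℚ)) geomSeries_mul_one_sub_X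
  rw [map_mul, map_sub, map_one, rescale_X] at h
  have hC : (C (-1) : ℚ⟦X⟧) = -1 := by simp
  rw [hC] at h
  rw [altGeomSeries]
  linear_combination h

theorem derivative_geomSeries : d⁄dX ℚ geomSeries = geomSeries ^ 2 := by
  have h := congrArg (d⁄dX ℚ) geomSeries_mul_one_sub_X
  simp only [Derivation.leibniz, map_sub, derivative_X, Derivation.map_one_eq_zero,
    smul_eq_mul] at h
  linear_combination geomSeries * h - d⁄dX ℚ geomSeries * geomSeries_mul_one_sub_X

theorem derivative_altGeomSeries : d⁄dX ℚ altGeomSeries = -altGeomSeries ^ 2 := by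
  have h := congrArg (d⁄dX ℚ) altGeomSeries_mul_one_add_X
  simp only [Derivation.leibniz, map_add, derivative_X, Derivation.map_one_eq_zero,
    smul_eq_mul] at h
  linear_combination altGeomSeries * h - d⁄dX ℚ altGeomSeries * altGeomSeries_mul_one_add_X

theorem derivative_oddPow (n : ℕ) : d⁄dX ℚ (oddPow n) = n * evenPow (n + 1) := by
  cases n with
  | zero => simp [oddPow]
  | succ n =>
    simp only [oddPow, evenPow, Derivation.leibniz, map_sub, derivative_C, smul_eq_mul,
      derivative_pow, derivative_geomSeries, derivative_altGeomSeries, Nat.add_sub_cancel]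
    ring

theorem derivative_evenPow (n : ℕ) : d⁄dX ℚ (evenPow n) = n * oddPow (n + 1) := by
  cases n with
  | zero => simp [evenPow]
  | succ n =>
    simp only [oddPow, evenPow, Derivation.leibniz, map_add, derivative_C, smul_eq_mul,
      derivative_pow, derivative_geomSeries, derivative_altGeomSeries, Nat.add_sub_cancel]
    ring

theorem oddPow_succ (n : ℕ) : oddPow (n + 1) = oddPow n + X * evenPow (n + 1) := by
  simp only [oddPow, evenPow]
  linear_combination C (1 / 2) * geomSeries ^ n * geomSeries_mul_one_sub_X -
    C (1 / 2) * altGeomSeries ^ n * altGeomSeries_mul_one_add_X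

theorem evenPow_succ (n : ℕ) : evenPow (n + 1) = evenPow n + X * oddPow (n + 1) := by
  simp only [oddPow, evenPow]
  linear_combination C (1 / 2) * geomSeries ^ n * geomSeries_mul_one_sub_X +
    C (1 / 2) * altGeomSeries ^ n * altGeomSeries_mul_one_add_X

theorem oddPow_add (a b : ℕ) :
    oddPow (a + b) = oddPow a * evenPow b + evenPow a * oddPow b := by
  simp only [oddPow, evenPow, pow_add]
  linear_combination (-C (1 / 2) * (geomSeries ^ a * geomSeries ^ b -
    altGeomSeries ^ a * altGeomSeries ^ b)) * C_half_mul_two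

/-- The odd parts of the powers, convolved over all splittings of `n + 2` into two positive
summands. -/
noncomputable def oddPowConv (n : ℕ) : ℚ⟦X⟧ :=
  ∑ x ∈ Finset.Icc 1 (n + 1), oddPow (n + 2 - x) * oddPow x

theorem X_mul_sum_mixed_pow (n : ℕ) :
    2 * X * ∑ x ∈ Finset.Icc 1 (n + 1),
      (geomSeries ^ (n + 2 - x) * altGeomSeries ^ x +
        altGeomSeries ^ (n + 2 - x) * geomSeries ^ x) =
      2 * (geomSeries ^ (n + 1) - altGeomSeries ^ (n + 1)) := by
  have hsum : ∀ u v : ℚ⟦X⟧, ∑ x ∈ Finset.Icc 1 (n + 1), u ^ (n + 2 - x) * v ^ x =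
      u * v * ∑ i ∈ Finset.range (n + 1), v ^ i * u ^ (n + 1 - 1 - i) := by
    intro u v
    rw [Finset.mul_sum, Finset.range_eq_Ico, Finset.sum_Ico_eq_sum_range,
      ← Finset.Ico_add_one_right_eq_Icc, Finset.sum_Ico_eq_sum_range]
    refine Finset.sum_congr rfl fun i hi => ?_
    have hi' : i < n + 1 := by simpa using hi
    obtain ⟨k, rfl⟩ : ∃ k, n = i + k := ⟨n - i, by omega⟩
    rw [show i + k + 2 - (1 + i) = k + 1 by omega, show i + k + 1 - 1 - (0 + i) = k by omega]
    ring
  have hdiff : geomSeries - altGeomSeries = 2 * X * (geomSeries * altGeomSeries) := by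
    linear_combination altGeomSeries * geomSeries_mul_one_sub_X -
      geomSeries * altGeomSeries_mul_one_add_X
  have h₁ := geom_sum₂_mul altGeomSeries geomSeries (n + 1)
  have h₂ := geom_sum₂_mul geomSeries altGeomSeries (n + 1)
  rw [Finset.sum_add_distrib, hsum, hsum]
  linear_combination h₂ - h₁ -
    (∑ i ∈ Finset.range (n + 1), altGeomSeries ^ i * geomSeries ^ (n + 1 - 1 - i) +
      ∑ i ∈ Finset.range (n + 1), geomSeries ^ i * altGeomSeries ^ (n + 1 - 1 - i)) * hdiff

theorem two_mul_X_mul_oddPowConv (n : ℕ) :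
    2 * X * oddPowConv n = X * ((n : ℚ⟦X⟧) + 1) * evenPow (n + 2) - oddPow (n + 1) := by
  have hconv : oddPowConv n = C (1 / 2) ^ 2 * (((n : ℚ⟦X⟧) + 1) * (geomSeries ^ (n + 2) +
      altGeomSeries ^ (n + 2)) - ∑ x ∈ Finset.Icc 1 (n + 1),
      (geomSeries ^ (n + 2 - x) * altGeomSeries ^ x +
        altGeomSeries ^ (n + 2 - x) * geomSeries ^ x)) := by
    have hcard : ((n : ℚ⟦X⟧) + 1) * (geomSeries ^ (n + 2) + altGeomSeries ^ (n + 2)) =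
        ∑ x ∈ Finset.Icc 1 (n + 1), (geomSeries ^ (n + 2) + altGeomSeries ^ (n + 2)) := by
      rw [Finset.sum_const, Nat.card_Icc, nsmul_eq_mul]
      push_cast
      simp
    rw [hcard, ← Finset.sum_sub_distrib, Finset.mul_sum, oddPowConv]
    refine Finset.sum_congr rfl fun x hx => ?_
    obtain ⟨k, hk⟩ : ∃ k, n + 2 = k + x := ⟨n + 2 - x, by have := Finset.mem_Icc.mp hx; omega⟩
    rw [hk, Nat.add_sub_cancel, oddPow, oddPow]
    ring
  rw [hconv, evenPow, oddPow]
  linear_combination (-C (1 / 2) ^ 2) * X_mul_sum_mixed_pow n +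
    (X * C (1 / 2) * ((n : ℚ⟦X⟧) + 1) * (geomSeries ^ (n + 2) + altGeomSeries ^ (n + 2)) -
      C (1 / 2) * (geomSeries ^ (n + 1) - altGeomSeries ^ (n + 1))) * C_half_mul_two

/-- The product of the odd parts `oddPow n` over the entries of a list. -/
noncomputable def oddPowProd (ns : List ℕ) : ℚ⟦X⟧ := (ns.map oddPow).prod

theorem oddPowProd_cons (n : ℕ) (ns : List ℕ) :
    oddPowProd (n :: ns) = oddPow n * oddPowProd ns := by
  simp [oddPowProd]

theorem sum_oddPow_mul_oddPowProd_eraseIdx (a : ℕ) (ns : List ℕ) :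
    ∑ j : Fin ns.length,
        (ns.get j : ℚ⟦X⟧) * (oddPow (a + ns.get j + 2) * oddPowProd (ns.eraseIdx j)) =
      (2 * X * evenPow (a + 1) + oddPow a) * d⁄dX ℚ (oddPowProd ns) +
        (ns.sum : ℚ⟦X⟧) * evenPow (a + 1) * oddPowProd ns := by
  induction ns with
  | nil => simp [oddPowProd]
  | cons b ns ih =>
    have hadd : oddPow (a + b + 2) =
        2 * X * evenPow (a + 1) * evenPow (b + 1) + evenPow (a + 1) * oddPow b +
          oddPow a * evenPow (b + 1) := by
      rw [show a + b + 2 = (a + 1) + (b + 1) by ring, oddPow_add, oddPow_succ a, oddPow_succ b]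
      ring
    simp only [List.length_cons, Fin.sum_univ_succ, List.get_eq_getElem, List.getElem_cons_zero, List.getElem_cons_succ,
      Fin.val_zero, Fin.val_succ, List.eraseIdx_cons_zero, List.eraseIdx_cons_succ,
      oddPowProd_cons, List.sum_cons, Nat.cast_add, Derivation.leibniz, smul_eq_mul,
      derivative_oddPow]
    have hpull : ∑ j : Fin ns.length, (ns.get j : ℚ⟦X⟧) *
        (oddPow (a + ns.get j + 2) * (oddPow b * oddPowProd (ns.eraseIdx j))) =
        oddPow b * ∑ j : Fin ns.length,
          (ns.get j : ℚ⟦X⟧) * (oddPow (a + ns.get j + 2) * oddPowProd (ns.eraseIdx j)) := by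
      rw [Finset.mul_sum]
      exact Finset.sum_congr rfl fun j _ => by ring
    simp only [List.get_eq_getElem] at hpull ih
    rw [hpull, ih, hadd]
    ring

/-- The sum over pairs of boundaries to be joined, at the level of generating series. -/
noncomputable def joinSeries (ns : List ℕ) : ℚ⟦X⟧ :=
  ∑ i : Fin ns.length, ∑ j ∈ Finset.Ioi i, (ns.get i : ℚ⟦X⟧) * (ns.get j : ℚ⟦X⟧) *
    oddPowProd ((ns.get i + ns.get j + 2) :: ((ns.eraseIdx j.val).eraseIdx i.val))

/-- The sum over boundaries to be split, at the level of generating series. -/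
noncomputable def splitSeries (ns : List ℕ) : ℚ⟦X⟧ :=
  ∑ i : Fin ns.length, (ns.get i : ℚ⟦X⟧) *
    (oddPowConv (ns.get i) * oddPowProd (ns.eraseIdx i.val))

theorem joinSeries_cons (a : ℕ) (ns : List ℕ) :
    joinSeries (a :: ns) =
      a * ∑ j : Fin ns.length,
        (ns.get j : ℚ⟦X⟧) * (oddPow (a + ns.get j + 2) * oddPowProd (ns.eraseIdx j)) +
      oddPow a * joinSeries ns := by
  rw [joinSeries, joinSeries]
  simp only [List.length_cons, Fin.sum_univ_succ, Fin.sum_Ioi_zero, Fin.sum_Ioi_succ,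
    List.get_eq_getElem, List.getElem_cons_zero, List.getElem_cons_succ, Fin.val_zero, Fin.val_succ,
    List.eraseIdx_cons_zero, List.eraseIdx_cons_succ, oddPowProd_cons, Finset.mul_sum]
  refine congrArg₂ (· + ·) ?_ ?_
  · exact Finset.sum_congr rfl fun j _ => by ring
  · exact Finset.sum_congr rfl fun i _ => Finset.sum_congr rfl fun j _ => by ring

theorem splitSeries_cons (a : ℕ) (ns : List ℕ) :
    splitSeries (a :: ns) =
      a * (oddPowConv a * oddPowProd ns) + oddPow a * splitSeries ns := by
  rw [splitSeries, splitSeries]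
  simp only [List.length_cons, Fin.sum_univ_succ,
    List.get_eq_getElem, List.getElem_cons_zero, List.getElem_cons_succ, Fin.val_zero, Fin.val_succ,
    List.eraseIdx_cons_zero, List.eraseIdx_cons_succ, oddPowProd_cons, Finset.mul_sum]
  exact congrArg₂ (· + ·) rfl (Finset.sum_congr rfl fun j _ => by ring)

/-- The differential equation satisfied by the product of the odd parts. -/
theorem oddPowProd_ode (ns : List ℕ) :
    X ^ 2 * d⁄dX ℚ (d⁄dX ℚ (oddPowProd ns)) +
        (ns.sum : ℚ⟦X⟧) * (X * d⁄dX ℚ (oddPowProd ns) - oddPowProd ns) =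
      X * (joinSeries ns + 2 * splitSeries ns) := by
  induction ns with
  | nil => simp [oddPowProd, joinSeries, splitSeries]
  | cons a ns ih =>
    rw [joinSeries_cons, splitSeries_cons, sum_oddPow_mul_oddPowProd_eraseIdx]
    simp only [oddPowProd_cons, List.sum_cons, Nat.cast_add, Derivation.leibniz, smul_eq_mul,
      map_add, derivative_oddPow, derivative_evenPow, Derivation.map_natCast, Nat.cast_one]
    have h₁ := two_mul_X_mul_oddPowConv a
    have h₂ := oddPow_succ a
    have h₃ : evenPow (a + 2) = evenPow (a + 1) + X * oddPow (a + 2) := evenPow_succ (a + 1)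
    linear_combination oddPow a * ih - a * oddPowProd ns * h₁ +
      a * oddPowProd ns * h₂ - X * a * ((a : ℚ⟦X⟧) + 1) * oddPowProd ns * h₃

theorem coeff_natCast_mul (a m : ℕ) (p : ℚ⟦X⟧) : coeff m ((a : ℚ⟦X⟧) * p) = a * coeff m p := by
  rw [← map_natCast (C (R := ℚ)), coeff_C_mul]

theorem coeff_oddPowProd_recursion (ns : List ℕ) (m : ℕ) :
    ((m : ℚ) + 1) * (ns.sum + m + 2) * coeff (m + 2) (oddPowProd ns) =
      coeff (m + 1) (joinSeries ns) + 2 * coeff (m + 1) (splitSeries ns) := by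
  have h := congrArg (coeff (m + 2)) (oddPowProd_ode ns)
  have htwo : (2 : ℚ⟦X⟧) = ((2 : ℕ) : ℚ⟦X⟧) := by norm_cast
  rw [map_add, coeff_natCast_mul, map_sub, coeff_X_pow_mul, coeff_succ_X_mul, coeff_succ_X_mul,
    map_add, htwo, coeff_natCast_mul, coeff_derivative, coeff_derivative] at h
  rw [Nat.cast_add, Nat.cast_one, Nat.cast_two] at h
  linear_combination h

/-- The generating series of the binomial coefficients `(2 * l + n).choose (2 * l + 1)`. -/
noncomputable def oddChooseSeries (n : ℕ) : ℚ⟦X⟧ :=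
  PowerSeries.mk fun l => ((2 * l + n).choose (2 * l + 1) : ℚ)

theorem oddPow_eq_X_mul_expand {n : ℕ} (hn : 0 < n) :
    oddPow n = X * expand 2 two_ne_zero (oddChooseSeries n) := by
  obtain ⟨n, rfl⟩ : ∃ k, n = k + 1 := ⟨n - 1, by omega⟩
  have hcoeff : ∀ m, coeff m (oddPow (n + 1)) =
      1 / 2 * (((n + m).choose n : ℚ) - (-1) ^ m * ((n + m).choose n : ℚ)) := by
    intro m
    rw [oddPow, altGeomSeries, ← map_pow, geomSeries, mk_one_pow_eq_mk_choose_add, coeff_C_mul,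
      map_sub, coeff_rescale, coeff_mk]
  ext m
  rw [hcoeff]
  cases m with
  | zero => simp
  | succ m =>
    rw [coeff_succ_X_mul, coeff_expand]
    split_ifs with h
    · obtain ⟨l, rfl⟩ := h
      rw [Nat.mul_div_cancel_left l two_pos, oddChooseSeries, coeff_mk, pow_succ, pow_mul,
        show 2 * l + (n + 1) = n + (2 * l + 1) by ring,
        Nat.choose_symm_add (a := n) (b := 2 * l + 1)]
      norm_num
      ring
    · have hm : Even (m + 1) := by
        rw [Nat.even_add_one, even_iff_two_dvd]
        exact h
      rw [hm.neg_one_pow]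
      ring

theorem oddPowProd_eq_X_pow_mul_expand (ns : List ℕ) (hpos : ∀ n ∈ ns, 0 < n) :
    oddPowProd ns =
      X ^ ns.length * expand 2 two_ne_zero (∏ k : Fin ns.length, oddChooseSeries (ns.get k)) := by
  simp only [List.get_eq_getElem]
  rw [Fin.prod_univ_fun_getElem]
  induction ns with
  | nil => simp [oddPowProd]
  | cons n ns ih =>
    rw [oddPowProd_cons, ih fun k hk => hpos k (List.mem_cons_of_mem n hk),
      oddPow_eq_X_mul_expand (hpos n List.mem_cons_self), List.map_cons, List.prod_cons,
      map_mul, List.length_cons]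
    ring

theorem coeff_prod_fin_eq_sum_antidiagonalTuple {L : ℕ} (f : Fin L → ℚ⟦X⟧) (g : ℕ) :
    coeff g (∏ k, f k) =
      ∑ lam ∈ Finset.Nat.antidiagonalTuple L g, ∏ k, coeff (lam k) (f k) := by
  rw [coeff_prod]
  refine Finset.sum_bij' (fun l _ => ⇑l) (fun l _ => Finsupp.equivFunOnFinite.symm l)
    ?_ ?_ ?_ ?_ ?_
  · intro l hl
    exact Finset.Nat.mem_antidiagonalTuple.mpr (Finset.mem_finsuppAntidiag.mp hl).1
  · intro l hl
    exact Finset.mem_finsuppAntidiag.mpr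
      ⟨Finset.Nat.mem_antidiagonalTuple.mp hl, Finset.subset_univ _⟩
  · intro l _
    exact Finsupp.equivFunOnFinite.symm_apply_apply l
  · intro l _
    rfl
  · intro l _
    rfl

theorem coeff_oddPowProd (ns : List ℕ) (hpos : ∀ n ∈ ns, 0 < n) (g : ℕ) :
    coeff (2 * g + ns.length) (oddPowProd ns) =
      (ns.map (fun n => (n : ℚ))).prod *
      ∑ lam ∈ Finset.Nat.antidiagonalTuple ns.length g,
        ∏ k : Fin ns.length,
          (Nat.factorial (2 * lam k + ns.get k) : ℚ) /
            ((Nat.factorial (ns.get k) : ℚ) * (Nat.factorial (2 * lam k + 1) : ℚ)) := by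
  have hprod : (ns.map (fun n => (n : ℚ))).prod = ∏ k : Fin ns.length, (ns.get k : ℚ) := by
    simp only [List.get_eq_getElem, Fin.prod_univ_fun_getElem ns (fun n : ℕ => (n : ℚ))]
    simp [← List.map_eq_flatMap, Function.comp_def]
  rw [oddPowProd_eq_X_pow_mul_expand ns hpos, coeff_X_pow_mul, coeff_expand_mul,
    coeff_prod_fin_eq_sum_antidiagonalTuple, hprod, Finset.mul_sum]
  refine Finset.sum_congr rfl fun lam _ => ?_
  rw [← Finset.prod_mul_distrib]
  refine Finset.prod_congr rfl fun k _ => ?_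
  have hk : 0 < ns.get k := hpos _ (List.get_mem ns k)
  obtain ⟨a, ha⟩ : ∃ a, ns.get k = a + 1 := ⟨ns.get k - 1, by omega⟩
  rw [ha, oddChooseSeries, coeff_mk, Nat.cast_choose ℚ (by omega),
    show 2 * lam k + (a + 1) - (2 * lam k + 1) = a by omega, Nat.factorial_succ a]
  push_cast
  field_simp

theorem coeff_oddPowProd_of_lt (ns : List ℕ) (hpos : ∀ n ∈ ns, 0 < n) {m : ℕ}
    (hm : m < ns.length) : coeff m (oddPowProd ns) = 0 := by
  rw [oddPowProd_eq_X_pow_mul_expand ns hpos, coeff_X_pow_mul', if_neg (by omega)]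

/-- The factor relating `Ncal` to the coefficients of `oddPowProd`. -/
noncomputable def factorialWeight (g : ℤ) (s m : ℕ) : ℚ :=
  (4 : ℚ) ^ (-g) * ((Nat.factorial (s + 2 * m - 3) : ℚ) / (Nat.factorial (s + m - 1) : ℚ))

theorem factorialWeight_sub_one (g : ℤ) (s m : ℕ) :
    factorialWeight (g - 1) s m = 4 * factorialWeight g s m := by
  rw [factorialWeight, factorialWeight, show -(g - 1) = -g + 1 by ring,
    zpow_add_one₀ (by norm_num)]
  ring

theorem factorialWeight_succ (g : ℤ) (s m : ℕ) :
    factorialWeight g s (m + 2) = (s + m + 2) * factorialWeight g (s + 2) (m + 1) := by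
  rw [factorialWeight, factorialWeight, show s + 2 * (m + 2) - 3 = s + 2 * m + 1 by omega,
    show s + 2 + 2 * (m + 1) - 3 = s + 2 * m + 1 by omega,
    show s + (m + 2) - 1 = s + m + 1 by omega,
    show s + 2 + (m + 1) - 1 = s + m + 1 + 1 by omega, Nat.factorial_succ (s + m + 1)]
  push_cast
  have h : (s : ℚ) + m + 1 + 1 ≠ 0 := by positivity
  field_simp
  ring

theorem Ncal_eq_factorialWeight_mul_coeff (g : ℤ) (ns : List ℕ) (hne : ns ≠ [])
    (hpos : ∀ n ∈ ns, 0 < n) (m : ℕ) (hm : (m : ℤ) = 2 * g + ns.length) :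
    Ncal g ns = factorialWeight g ns.sum m * coeff m (oddPowProd ns) := by
  rcases lt_or_ge g 0 with hg | hg
  · rw [Ncal, if_pos (Or.inl hg), coeff_oddPowProd_of_lt ns hpos (by omega), mul_zero]
  · obtain ⟨g, rfl⟩ := Int.eq_ofNat_of_zero_le hg
    obtain rfl : m = 2 * g + ns.length := by omega
    rw [Ncal, if_neg (by simp [hne]), coeff_oddPowProd ns hpos, factorialWeight, zpow_neg,
      zpow_natCast, Int.toNat_natCast,
      show ns.sum + 2 * (2 * g + ns.length) - 3 = ns.sum + 4 * g + 2 * ns.length - 3 by omega,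
      show ns.sum + (2 * g + ns.length) - 1 = ns.sum + 2 * g + ns.length - 1 by omega]
    ring

end SignedGeometricSeries

section Recursion

open PowerSeries

theorem cons_get_eraseIdx_perm (ns : List ℕ) (i : Fin ns.length) :
    (ns.get i :: ns.eraseIdx i.val).Perm ns :=
  List.getElem_cons_eraseIdx_perm i.isLt

theorem cons_get_cons_get_eraseIdx_perm (ns : List ℕ) {i j : Fin ns.length} (hij : i < j) :
    (ns.get i :: ns.get j :: (ns.eraseIdx j.val).eraseIdx i.val).Perm ns := by
  have hlen := List.length_eraseIdx_of_lt j.isLt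
  have hlt : i.val < (ns.eraseIdx j.val).length := by omega
  have h := List.getElem_cons_eraseIdx_perm hlt
  rw [List.getElem_eraseIdx_of_lt hlt hij] at h
  exact (List.Perm.swap _ _ _).trans ((h.cons _).trans (cons_get_eraseIdx_perm ns j))

/-- The data of a list obtained by joining two entries. -/
theorem join_list_spec (ns : List ℕ) (hpos : ∀ n ∈ ns, 0 < n) {i j : Fin ns.length}
    (hij : i < j) :
    (∀ n ∈ (ns.get i + ns.get j + 2) :: (ns.eraseIdx j.val).eraseIdx i.val, 0 < n) ∧
    ((ns.get i + ns.get j + 2) :: (ns.eraseIdx j.val).eraseIdx i.val).sum = ns.sum + 2 ∧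
    ((ns.get i + ns.get j + 2) :: (ns.eraseIdx j.val).eraseIdx i.val).length + 1 =
      ns.length := by
  have hperm := cons_get_cons_get_eraseIdx_perm ns hij
  have hsum := hperm.sum_eq
  have hlen := hperm.length_eq
  refine ⟨fun n hn => ?_, ?_, ?_⟩
  · rcases List.mem_cons.mp hn with rfl | hn
    · omega
    · exact hpos n (hperm.subset (List.mem_cons_of_mem _ (List.mem_cons_of_mem _ hn)))
  · simp only [List.sum_cons] at hsum ⊢
    omega
  · simpa only [List.length_cons] using hlen

/-- The data of a list obtained by splitting an entry. -/
theorem split_list_spec (ns : List ℕ) (hpos : ∀ n ∈ ns, 0 < n) (i : Fin ns.length) {x : ℕ}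
    (hx : x ∈ Finset.Icc 1 (ns.get i + 1)) :
    (∀ n ∈ (ns.get i + 2 - x) :: x :: ns.eraseIdx i.val, 0 < n) ∧
    ((ns.get i + 2 - x) :: x :: ns.eraseIdx i.val).sum = ns.sum + 2 ∧
    ((ns.get i + 2 - x) :: x :: ns.eraseIdx i.val).length = ns.length + 1 := by
  have hperm := cons_get_eraseIdx_perm ns i
  have hsum := hperm.sum_eq
  have hlen := hperm.length_eq
  rw [Finset.mem_Icc] at hx
  refine ⟨fun n hn => ?_, ?_, ?_⟩
  · rcases List.mem_cons.mp hn with rfl | hn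
    · omega
    · rcases List.mem_cons.mp hn with rfl | hn
      · omega
      · exact hpos n (hperm.subset (List.mem_cons_of_mem _ hn))
  · simp only [List.sum_cons] at hsum ⊢
    omega
  · simp only [List.length_cons] at hlen ⊢
    omega

theorem sum_Ncal_join (g : ℤ) (ns : List ℕ) (hpos : ∀ n ∈ ns, 0 < n) (m : ℕ)
    (hm : (m : ℤ) + 1 = 2 * g + ns.length) :
    (∑ i : Fin ns.length, ∑ j ∈ Finset.Ioi i,
      (ns.get i : ℚ) * (ns.get j : ℚ) *
        Ncal g ((ns.get i + ns.get j + 2) :: ((ns.eraseIdx j.val).eraseIdx i.val))) =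
      factorialWeight g (ns.sum + 2) m * coeff m (joinSeries ns) := by
  rw [joinSeries, map_sum, Finset.mul_sum]
  refine Finset.sum_congr rfl fun i _ => ?_
  rw [map_sum, Finset.mul_sum]
  refine Finset.sum_congr rfl fun j hj => ?_
  obtain ⟨hpos', hsum, hlen⟩ := join_list_spec ns hpos (Finset.mem_Ioi.mp hj)
  rw [Ncal_eq_factorialWeight_mul_coeff g _ (List.cons_ne_nil _ _) hpos' m (by omega), hsum,
    mul_assoc (ns.get i : ℚ⟦X⟧), coeff_natCast_mul, coeff_natCast_mul]
  ring

theorem sum_Ncal_split (g : ℤ) (ns : List ℕ) (hpos : ∀ n ∈ ns, 0 < n) (m : ℕ)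
    (hm : (m : ℤ) + 1 = 2 * g + ns.length) :
    (∑ i : Fin ns.length, (ns.get i : ℚ) *
      ∑ x ∈ Finset.Icc 1 (ns.get i + 1),
        Ncal (g - 1) ((ns.get i + 2 - x) :: x :: (ns.eraseIdx i.val))) =
      4 * factorialWeight g (ns.sum + 2) m * coeff m (splitSeries ns) := by
  rw [splitSeries, map_sum, Finset.mul_sum]
  refine Finset.sum_congr rfl fun i _ => ?_
  rw [coeff_natCast_mul, oddPowConv, Finset.sum_mul, map_sum, mul_left_comm,
    Finset.mul_sum _ _ (4 * _)]
  refine congrArg _ (Finset.sum_congr rfl fun x hx => ?_)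
  obtain ⟨hpos', hsum, hlen⟩ := split_list_spec ns hpos i hx
  rw [Ncal_eq_factorialWeight_mul_coeff (g - 1) _ (List.cons_ne_nil _ _) hpos' m (by omega), hsum,
    factorialWeight_sub_one, oddPowProd_cons, oddPowProd_cons, mul_assoc (oddPow _)]

/-- The explicit formula satisfies the cut-and-join recursion. -/
theorem Ncal_recursion (g : ℤ) (ns : List ℕ) (hne : ns ≠ []) (hpos : ∀ n ∈ ns, 0 < n)
    (hlarge : (1 : ℤ) ≤ (ns.length : ℤ) + 2 * g - 1) :
    ((ns.length : ℚ) + 2 * (g : ℚ) - 1) * Ncal g ns =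
      (∑ i : Fin ns.length, ∑ j ∈ Finset.Ioi i,
        (ns.get i : ℚ) * (ns.get j : ℚ) *
          Ncal g ((ns.get i + ns.get j + 2) :: ((ns.eraseIdx j.val).eraseIdx i.val))) +
      (1 / 2 : ℚ) * ∑ i : Fin ns.length, (ns.get i : ℚ) *
        ∑ x ∈ Finset.Icc 1 (ns.get i + 1),
          Ncal (g - 1) ((ns.get i + 2 - x) :: x :: (ns.eraseIdx i.val)) := by
  obtain ⟨m, hm⟩ : ∃ m : ℕ, ((m + 2 : ℕ) : ℤ) = 2 * g + ns.length :=
    ⟨(2 * g + ns.length - 2).toNat, by omega⟩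
  have hmq : (m : ℚ) + 2 = 2 * g + ns.length := by exact_mod_cast hm
  rw [sum_Ncal_join g ns hpos (m + 1) (by omega), sum_Ncal_split g ns hpos (m + 1) (by omega),
    Ncal_eq_factorialWeight_mul_coeff g ns hne hpos (m + 2) hm, factorialWeight_succ]
  linear_combination factorialWeight g (ns.sum + 2) (m + 1) * coeff_oddPowProd_recursion ns m -
    ((ns.sum : ℚ) + m + 2) * factorialWeight g (ns.sum + 2) (m + 1) *
      coeff (m + 2) (oddPowProd ns) * hmq

theorem Ncal_zero_singleton {n : ℕ} (hn : 0 < n) : Ncal 0 [n] = 1 := by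
  obtain ⟨n, rfl⟩ : ∃ k, n = k + 1 := ⟨n - 1, by omega⟩
  rw [Ncal, if_neg (by simp)]
  simp [Finset.Nat.antidiagonalTuple_one, Nat.factorial_succ]
  have h : (Nat.factorial n : ℚ) ≠ 0 := by positivity
  field_simp

end Recursion

/-- **Uniqueness in Theorem I.** Any assignment `G` of rational numbers to tuples of positive
integers which vanishes for `g < 0` or `L ≤ 0`, has initial value `G_{0,1}(n) = 1`, and
satisfies the recursion of Lemma I whenever `L + 2g − 1 ≥ 1`, coincides with the explicit
formula `N_{g,L}` on positive-integer tuples. -/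
theorem Ncal_unique (G : ℤ → List ℕ → ℚ)
    (h0 : ∀ (g : ℤ) (ns : List ℕ), (g < 0 ∨ ns = []) → G g ns = 0)
    (hinit : ∀ n : ℕ, 0 < n → G 0 [n] = 1)
    (hrec : ∀ (g : ℤ), 0 ≤ g → ∀ ns : List ℕ, 1 ≤ ns.length → (∀ n ∈ ns, 0 < n) →
      (1 : ℤ) ≤ (ns.length : ℤ) + 2 * g - 1 →
      ((ns.length : ℚ) + 2 * (g : ℚ) - 1) * G g ns =
        (∑ i : Fin ns.length, ∑ j ∈ Finset.Ioi i,
          (ns.get i : ℚ) * (ns.get j : ℚ) *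
            G g ((ns.get i + ns.get j + 2) :: ((ns.eraseIdx j.val).eraseIdx i.val))) +
        (1 / 2 : ℚ) * ∑ i : Fin ns.length, (ns.get i : ℚ) *
          ∑ x ∈ Finset.Icc 1 (ns.get i + 1),
            G (g - 1) ((ns.get i + 2 - x) :: x :: (ns.eraseIdx i.val))) :
    ∀ (g : ℤ), 0 ≤ g → ∀ ns : List ℕ, 1 ≤ ns.length → (∀ n ∈ ns, 0 < n) →
      G g ns = Ncal g ns := by
  have key : ∀ (m : ℕ) (g : ℤ), 0 ≤ g → ∀ ns : List ℕ, 1 ≤ ns.length → (∀ n ∈ ns, 0 < n) →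
      2 * g + ns.length = m + 1 → G g ns = Ncal g ns := by
    intro m
    induction m with
    | zero =>
      intro g hg ns hlen hpos hm
      obtain rfl : g = 0 := by omega
      obtain ⟨n, rfl⟩ := List.length_eq_one_iff.mp (show ns.length = 1 by omega)
      have hn := hpos n List.mem_cons_self
      rw [hinit n hn, Ncal_zero_singleton hn]
    | succ m ih =>
      intro g hg ns hlen hpos hm
      push_cast at hm
      have hlarge : (1 : ℤ) ≤ (ns.length : ℤ) + 2 * g - 1 := by omega
      have hne : ns ≠ [] := List.length_pos_iff.mp hlen
      have hcoef : (ns.length : ℚ) + 2 * (g : ℚ) - 1 ≠ 0 := by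
        have : (ns.length : ℤ) + 2 * g - 1 ≠ 0 := by omega
        exact_mod_cast this
      refine mul_left_cancel₀ hcoef ?_
      rw [hrec g hg ns hlen hpos hlarge, Ncal_recursion g ns hne hpos hlarge]
      refine congrArg₂ (· + ·) (Finset.sum_congr rfl fun i _ => Finset.sum_congr rfl fun j hj => ?_)
        (congrArg _ (Finset.sum_congr rfl fun i _ => congrArg _
          (Finset.sum_congr rfl fun x hx => ?_)))
      · obtain ⟨hpos', -, hlen'⟩ := join_list_spec ns hpos (Finset.mem_Ioi.mp hj)
        rw [ih g hg _ (by simp) hpos' (by omega)]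
      · obtain ⟨hpos', -, hlen'⟩ := split_list_spec ns hpos i hx
        rcases lt_or_ge (g - 1) 0 with hneg | hnonneg
        · rw [h0 _ _ (Or.inl hneg), Ncal, if_pos (Or.inl hneg)]
        · rw [ih (g - 1) hnonneg _ (by simp) hpos' (by omega)]
  intro g hg ns hlen hpos
  exact key (2 * g + ns.length - 1).toNat g hg ns hlen hpos (by omega)
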